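/- arXiv:1605.02141 — 2 statements merged into one kernel-verified Lean document; each statement's English description precedes it below -/
import Mathlib

section
/- Let D ∈ ℝ^{m×m} be a diagonal matrix with strictly positive diagonal entries, let K ∈ ℝ^{m×m} be symmetric, and let H_c be the 2m×2m real block matrix H_c = [[D+K, K], [−K, −(D+K)]]. If λ ∈ ℂ and (x, y) ∈ ℂ^{m} × ℂ^{m} satisfy H_c (x, y) = λ (x, y) with x + y ≠ 0, then λ² is an eigenvalue of the symmetric matrix D² + 2 D^{1/2} K D^{1/2}, where D^{1/2} is the diagonal matrix of positive square roots of the diagonal entries of D. -/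
open Matrix

/-- Let `D = diagonal d` with `d i > 0`, `K` real symmetric, and let
`H_c = [[D+K, K], [−K, −(D+K)]]` be the Casida-type block matrix (regarded over ℂ). If
`H_c (x, y) = λ (x, y)` with `x + y ≠ 0`, then `λ²` is an eigenvalue of the symmetric matrix
`D² + 2 D^{1/2} K D^{1/2}`, where `D^{1/2} = diagonal (√(d i))`. -/
theorem casida_eigenvalue_reduction {m : ℕ} (d : Fin m → ℝ) (hd : ∀ i, 0 < d i)
    (K : Matrix (Fin m) (Fin m) ℝ) (hK : Kᵀ = K)
    (lam : ℂ) (x y : Fin m → ℂ)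
    (heig :
      (Matrix.fromBlocks
          ((Matrix.diagonal d + K).map Complex.ofReal)
          (K.map Complex.ofReal)
          ((-K).map Complex.ofReal)
          ((-(Matrix.diagonal d + K)).map Complex.ofReal)) *ᵥ Sum.elim x y =
        lam • Sum.elim x y)
    (hxy : x + y ≠ 0) :
    ∃ w : Fin m → ℂ, w ≠ 0 ∧
      ((Matrix.diagonal d ^ 2 +
          (2 : ℝ) • (Matrix.diagonal (fun i => Real.sqrt (d i)) * K *
            Matrix.diagonal (fun i => Real.sqrt (d i)))).map Complex.ofReal) *ᵥ w =
        lam ^ 2 • w := by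
  have hr0 : ∀ i, (Real.sqrt (d i) : ℂ) ≠ 0 := fun i =>
    Complex.ofReal_ne_zero.mpr (Real.sqrt_pos.mpr (hd i)).ne'
  have hr2 : ∀ i, (Real.sqrt (d i) : ℂ) * Real.sqrt (d i) = d i := fun i => by
    rw [← Complex.ofReal_mul, Real.mul_self_sqrt (hd i).le]
  set L := K.map Complex.ofReal with hL
  have hD : (diagonal d).map Complex.ofReal = diagonal fun i => (d i : ℂ) :=
    diagonal_map Complex.ofReal_zero
  have hDK : (diagonal d + K).map Complex.ofReal = (diagonal fun i => (d i : ℂ)) + L := by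
    rw [Matrix.map_add _ Complex.ofReal_add, hD]
  have hneg : ∀ A : Matrix (Fin m) (Fin m) ℝ,
      (-A).map Complex.ofReal = -A.map Complex.ofReal := fun A => by ext; simp
  rw [hneg, hneg, hDK, fromBlocks_mulVec] at heig
  have hx : ∀ i, (d i : ℂ) * x i + (L *ᵥ x) i + (L *ᵥ y) i = lam * x i := fun i => by
    simpa [add_mulVec, mulVec_diagonal] using congrFun heig (Sum.inl i)
  have hy : ∀ i, -(L *ᵥ x) i - ((d i : ℂ) * y i + (L *ᵥ y) i) = lam * y i := fun i => by
    have h := congrFun heig (Sum.inr i)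
    simp [add_mulVec, neg_mulVec, mulVec_diagonal] at h
    linear_combination h
  set w : Fin m → ℂ := fun i => (x i + y i) / Real.sqrt (d i) with hw
  have hrw : (diagonal fun i => (Real.sqrt (d i) : ℂ)) *ᵥ w = x + y := by
    ext i
    simp only [mulVec_diagonal, hw, Pi.add_apply]
    exact mul_div_cancel₀ _ (hr0 i)
  refine ⟨w, fun h => hxy (by rw [← hrw, h, mulVec_zero]), ?_⟩
  have hM : (diagonal d ^ 2 +
      (2 : ℝ) • (diagonal (fun i => Real.sqrt (d i)) * K *
        diagonal (fun i => Real.sqrt (d i)))).map Complex.ofReal =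
      (diagonal fun i => (d i : ℂ) ^ 2) +
        (2 : ℂ) • ((diagonal fun i => (Real.sqrt (d i) : ℂ)) * L *
          diagonal fun i => (Real.sqrt (d i) : ℂ)) := by
    ext i j
    by_cases hij : i = j
    · subst hij
      simp [hL, diagonal_pow, diagonal_mul, mul_diagonal]
    · simp [hL, diagonal_pow, diagonal_mul, mul_diagonal, hij]
  rw [hM, add_mulVec, smul_mulVec, ← mulVec_mulVec, ← mulVec_mulVec, hrw]
  ext i
  have hwi : w i * Real.sqrt (d i) = x i + y i := div_mul_cancel₀ _ (hr0 i)
  simp only [Pi.add_apply, Pi.smul_apply, mulVec_diagonal, mulVec_add, smul_eq_mul]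
  apply mul_right_cancel₀ (hr0 i)
  linear_combination ((d i : ℂ) ^ 2 - lam ^ 2) * hwi +
    2 * ((L *ᵥ x) i + (L *ᵥ y) i) * hr2 i + ((d i : ℂ) + lam) * hx i + (lam - d i) * hy i
end

section
/- Let ψ₁, …, ψ_n ∈ ℝⁿ be an orthonormal basis of eigenvectors of a real symmetric matrix H ∈ ℝ^{n×n} with H ψⱼ = εⱼ ψⱼ, fix 1 ≤ m < n, set P^⊥ := I − ∑_{j=1}^{m} ψⱼ ψⱼᵀ, ρ_{ij} := ψᵢ ⊙ ψⱼ, and for ω ∈ ℂ with Im ω ≠ 0 define χ₀(ω) := 2 ∑_{i=1}^{m} ∑_{j=m+1}^{n} ρ_{ij} ρ_{ij}ᵀ ( (ω − (εⱼ − εᵢ))⁻¹ − (ω + (εⱼ − εᵢ))⁻¹ ). Then for every g ∈ ℂⁿ, the matrices H − (εᵢ + ω) I and H − (εᵢ − ω) I (over ℂ) are invertible for each i ≤ m, and χ₀(ω) g = 2 ∑_{i=1}^{m} Diag(ψᵢ) (xᵢ + yᵢ), where xᵢ is the unique solution of (H − (εᵢ + ω) I) xᵢ = −P^⊥ Diag(ψᵢ)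 g and yᵢ is the unique solution of (H − (εᵢ − ω) I) yᵢ = −P^⊥ Diag(ψᵢ) g. -/
open Matrix

/-- The irreducible polarizability
`χ₀(ω) = 2 ∑_{i occupied} ∑_{j unoccupied} ρ_{ij} ρ_{ij}ᵀ ((ω − (εⱼ − εᵢ))⁻¹ − (ω + (εⱼ − εᵢ))⁻¹)`
in spectral form (η = 0), where `ρ_{ij} = ψᵢ ⊙ ψⱼ` is the entrywise product of the real
orbitals `ψᵢ, ψⱼ ∈ ℝⁿ`, with `m` occupied states out of `n`. -/
noncomputable def irreduciblePolarizability {n : ℕ} (ψ : Fin n → (Fin n → ℝ))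
    (ε : Fin n → ℝ) (m : ℕ) (ω : ℂ) : Matrix (Fin n) (Fin n) ℂ :=
  2 • ∑ i ∈ Finset.univ.filter (fun i : Fin n => (i : ℕ) < m),
      ∑ j ∈ Finset.univ.filter (fun j : Fin n => m ≤ (j : ℕ)),
        ((ω - ((ε j - ε i : ℝ) : ℂ))⁻¹ - (ω + ((ε j - ε i : ℝ) : ℂ))⁻¹) •
          Matrix.vecMulVec (fun r => ((ψ i r * ψ j r : ℝ) : ℂ)) (fun r => ((ψ i r * ψ j r : ℝ) : ℂ))

section OrthonormalExpansion

variable {ι : Type*} [Fintype ι] [DecidableEq ι] {φ : ι → ι → ℂ}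

/-- Expansion of a vector in a basis that is orthonormal for the bilinear dot product. -/
theorem sum_dotProduct_smul_of_orthonormal
    (horth : ∀ i j, φ i ⬝ᵥ φ j = if i = j then (1 : ℂ) else 0) (v : ι → ℂ) :
    ∑ j, (φ j ⬝ᵥ v) • φ j = v := by
  have h : Matrix.of φ * (Matrix.of φ)ᵀ = 1 := by
    ext i j
    simpa [Matrix.mul_apply, Matrix.one_apply, dotProduct] using horth i j
  have h' : (Matrix.of φ)ᵀ * Matrix.of φ = 1 := mul_eq_one_comm.mp h
  calc ∑ j, (φ j ⬝ᵥ v) • φ j = (Matrix.of φ)ᵀ *ᵥ (Matrix.of φ *ᵥ v) := by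
        ext r
        simp [Matrix.mulVec, dotProduct, mul_comm]
    _ = v := by rw [Matrix.mulVec_mulVec, h', Matrix.one_mulVec]

/-- Coefficients of `(A - z) v` along an eigenvector of a symmetric matrix `A`. -/
theorem dotProduct_sub_smul_one_mulVec {A : Matrix ι ι ℂ} (hA : Aᵀ = A) {u : ι → ℂ} {a : ℂ}
    (hu : A *ᵥ u = a • u) (z : ℂ) (v : ι → ℂ) :
    u ⬝ᵥ ((A - z • (1 : Matrix ι ι ℂ)) *ᵥ v) = (a - z) * (u ⬝ᵥ v) := by
  have h : u ⬝ᵥ (A *ᵥ v) = a * (u ⬝ᵥ v) := by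
    rw [Matrix.dotProduct_mulVec, ← Matrix.mulVec_transpose, hA, hu, smul_dotProduct, smul_eq_mul]
  rw [Matrix.sub_mulVec, Matrix.smul_mulVec, Matrix.one_mulVec, dotProduct_sub, h,
    dotProduct_smul, smul_eq_mul, sub_mul]

theorem isUnit_sub_smul_one_of_orthonormal {A : Matrix ι ι ℂ} (hA : Aᵀ = A) {a : ι → ℂ}
    (horth : ∀ i j, φ i ⬝ᵥ φ j = if i = j then (1 : ℂ) else 0)
    (heig : ∀ j, A *ᵥ φ j = a j • φ j) {z : ℂ} (hz : ∀ j, a j ≠ z) :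
    IsUnit (A - z • (1 : Matrix ι ι ℂ)) := by
  rw [← Matrix.mulVec_injective_iff_isUnit]
  refine (injective_iff_map_eq_zero (Matrix.mulVecLin (A - z • (1 : Matrix ι ι ℂ)))).mpr ?_
  intro v hv
  rw [Matrix.mulVecLin_apply] at hv
  rw [← sum_dotProduct_smul_of_orthonormal horth v]
  refine Finset.sum_eq_zero fun j _ => ?_
  have h := dotProduct_sub_smul_one_mulVec hA (heig j) z v
  rw [hv, dotProduct_zero, eq_comm, mul_eq_zero, sub_eq_zero] at h
  rw [h.resolve_left (hz j), zero_smul]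

/-- Spectral form of the solution of a shifted linear system whose right-hand side is projected
onto the orthogonal complement of the eigenvectors indexed by `s`. -/
theorem eq_sum_of_sub_smul_one_mulVec_eq {A : Matrix ι ι ℂ} (hA : Aᵀ = A) {a : ι → ℂ}
    (horth : ∀ i j, φ i ⬝ᵥ φ j = if i = j then (1 : ℂ) else 0)
    (heig : ∀ j, A *ᵥ φ j = a j • φ j) {z : ℂ} (hz : ∀ j, a j ≠ z) (s : Finset ι)
    {v w : ι → ℂ}
    (hv : (A - z • (1 : Matrix ι ι ℂ)) *ᵥ v =
      -(((1 : Matrix ι ι ℂ) - ∑ j ∈ s, Matrix.vecMulVec (φ j) (φ j)) *ᵥ w)) :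
    v = ∑ j ∈ sᶜ, ((z - a j)⁻¹ * (φ j ⬝ᵥ w)) • φ j := by
  have hcoeff (j : ι) : φ j ⬝ᵥ v = if j ∈ s then 0 else (z - a j)⁻¹ * (φ j ⬝ᵥ w) := by
    have h := dotProduct_sub_smul_one_mulVec hA (heig j) z v
    have hproj : φ j ⬝ᵥ ((∑ k ∈ s, Matrix.vecMulVec (φ k) (φ k)) *ᵥ w) =
        if j ∈ s then φ j ⬝ᵥ w else 0 := by
      simp [Matrix.sum_mulVec, dotProduct_sum, Matrix.vecMulVec_mulVec, horth]
    rw [hv, dotProduct_neg, Matrix.sub_mulVec, Matrix.one_mulVec, dotProduct_sub, hproj] at h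
    have hne : z - a j ≠ 0 := sub_ne_zero.mpr (hz j).symm
    split_ifs at h ⊢ with hj
    · have : (z - a j) * (φ j ⬝ᵥ v) = 0 := by linear_combination h
      exact (mul_eq_zero.mp this).resolve_left hne
    · rw [eq_inv_mul_iff_mul_eq₀ hne]
      linear_combination h
  rw [← sum_dotProduct_smul_of_orthonormal horth v, ← Finset.sum_add_sum_compl s]
  have h0 : ∑ j ∈ s, (φ j ⬝ᵥ v) • φ j = 0 :=
    Finset.sum_eq_zero fun j hj => by rw [hcoeff, if_pos hj, zero_smul]
  rw [h0, zero_add]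
  exact Finset.sum_congr rfl fun j hj => by rw [hcoeff, if_neg (Finset.mem_compl.mp hj)]

end OrthonormalExpansion

/-- (Sternheimer equations.) Let `ψ₁, …, ψ_n` be an orthonormal basis of
eigenvectors of the real symmetric matrix `H` with `H ψⱼ = εⱼ ψⱼ`, `1 ≤ m < n`,
`P^⊥ := I − ∑_{j≤m} ψⱼψⱼᵀ`, and let `ω ∈ ℂ` with `Im ω ≠ 0`. Then for each occupied `i` the
matrices `H − (εᵢ + ω) I` and `H − (εᵢ − ω) I` (over ℂ) are invertible, and for every
`g ∈ ℂⁿ`, if `xᵢ` solves `(H − (εᵢ + ω) I) xᵢ = −P^⊥ Diag(ψᵢ) g` and `yᵢ` solves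
`(H − (εᵢ − ω) I) yᵢ = −P^⊥ Diag(ψᵢ) g` for every occupied `i`, then
`χ₀(ω) g = 2 ∑_{i occupied} Diag(ψᵢ) (xᵢ + yᵢ)`. -/
theorem sternheimer_polarizability_apply {n : ℕ} (H : Matrix (Fin n) (Fin n) ℝ)
    (hH : Hᵀ = H) (ψ : Fin n → (Fin n → ℝ)) (ε : Fin n → ℝ)
    (horth : ∀ i j, ψ i ⬝ᵥ ψ j = if i = j then (1 : ℝ) else 0)
    (heig : ∀ j, H *ᵥ ψ j = ε j • ψ j)
    (m : ℕ) (hm : 1 ≤ m) (hmn : m < n) (ω : ℂ) (hω : ω.im ≠ 0) :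
    (∀ i : Fin n, (i : ℕ) < m →
      IsUnit (H.map Complex.ofReal - ((ε i : ℂ) + ω) • (1 : Matrix (Fin n) (Fin n) ℂ)) ∧
      IsUnit (H.map Complex.ofReal - ((ε i : ℂ) - ω) • (1 : Matrix (Fin n) (Fin n) ℂ))) ∧
    ∀ g : Fin n → ℂ, ∀ x y : Fin n → (Fin n → ℂ),
      (∀ i ∈ Finset.univ.filter (fun i : Fin n => (i : ℕ) < m),
        (H.map Complex.ofReal - ((ε i : ℂ) + ω) • (1 : Matrix (Fin n) (Fin n) ℂ)) *ᵥ x i =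
          -(((1 : Matrix (Fin n) (Fin n) ℂ) -
              ∑ j ∈ Finset.univ.filter (fun j : Fin n => (j : ℕ) < m),
                Matrix.vecMulVec (fun r => ((ψ j r : ℝ) : ℂ)) (fun r => ((ψ j r : ℝ) : ℂ))) *ᵥ
            (Matrix.diagonal (fun r => ((ψ i r : ℝ) : ℂ)) *ᵥ g))) →
      (∀ i ∈ Finset.univ.filter (fun i : Fin n => (i : ℕ) < m),
        (H.map Complex.ofReal - ((ε i : ℂ) - ω) • (1 : Matrix (Fin n) (Fin n) ℂ)) *ᵥ y i =
          -(((1 : Matrix (Fin n) (Fin n) ℂ) -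
              ∑ j ∈ Finset.univ.filter (fun j : Fin n => (j : ℕ) < m),
                Matrix.vecMulVec (fun r => ((ψ j r : ℝ) : ℂ)) (fun r => ((ψ j r : ℝ) : ℂ))) *ᵥ
            (Matrix.diagonal (fun r => ((ψ i r : ℝ) : ℂ)) *ᵥ g))) →
      irreduciblePolarizability ψ ε m ω *ᵥ g =
        (2 : ℂ) • ∑ i ∈ Finset.univ.filter (fun i : Fin n => (i : ℕ) < m),
          Matrix.diagonal (fun r => ((ψ i r : ℝ) : ℂ)) *ᵥ (x i + y i) := by
  set φ : Fin n → Fin n → ℂ := fun j r => ((ψ j r : ℝ) : ℂ) with hφ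
  set A : Matrix (Fin n) (Fin n) ℂ := H.map Complex.ofReal with hAdef
  have hA : Aᵀ = A := by rw [hAdef, ← Matrix.transpose_map, hH]
  have hφorth : ∀ i j, φ i ⬝ᵥ φ j = if i = j then (1 : ℂ) else 0 := by
    intro i j
    have h := congrArg Complex.ofReal (horth i j)
    simpa [hφ, dotProduct, apply_ite Complex.ofReal] using h
  have hφeig : ∀ j, A *ᵥ φ j = (ε j : ℂ) • φ j := by
    intro j
    ext r
    have h := congrArg Complex.ofReal (congrFun (heig j) r)
    simpa [hφ, hAdef, Matrix.mulVec, dotProduct] using h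
  have hadd : ∀ i j : Fin n, (ε j : ℂ) ≠ (ε i : ℂ) + ω := by
    intro i j h
    exact hω (by simpa using (congrArg Complex.im h).symm)
  have hsub : ∀ i j : Fin n, (ε j : ℂ) ≠ (ε i : ℂ) - ω := by
    intro i j h
    exact hω (by simpa using (congrArg Complex.im h).symm)
  refine ⟨fun i _ => ⟨isUnit_sub_smul_one_of_orthonormal hA hφorth hφeig (hadd i),
    isUnit_sub_smul_one_of_orthonormal hA hφorth hφeig (hsub i)⟩, ?_⟩
  intro g x y hx hy
  have hcompl : (Finset.univ.filter (fun j : Fin n => (j : ℕ) < m))ᶜ =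
      Finset.univ.filter (fun j : Fin n => m ≤ (j : ℕ)) := by
    ext j
    simp
  have hρ (i j : Fin n) :
      (fun r => ((ψ i r * ψ j r : ℝ) : ℂ)) = Matrix.diagonal (φ i) *ᵥ φ j := by
    ext r
    simp [hφ, Matrix.mulVec_diagonal]
  have hρg (i j : Fin n) :
      (Matrix.diagonal (φ i) *ᵥ φ j) ⬝ᵥ g = φ j ⬝ᵥ (Matrix.diagonal (φ i) *ᵥ g) := by
    simp only [dotProduct, Matrix.mulVec_diagonal]
    exact Finset.sum_congr rfl fun r _ => by ring
  have hinv (i j : Fin n) :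
      (ω - ((ε j - ε i : ℝ) : ℂ))⁻¹ - (ω + ((ε j - ε i : ℝ) : ℂ))⁻¹ =
        ((ε i : ℂ) + ω - ε j)⁻¹ + ((ε i : ℂ) - ω - ε j)⁻¹ := by
    rw [sub_eq_add_neg, ← inv_neg]
    push_cast
    congr 2 <;> ring
  rw [irreduciblePolarizability, ← Nat.cast_smul_eq_nsmul ℂ, Matrix.smul_mulVec,
    Matrix.sum_mulVec, Nat.cast_ofNat]
  congr 1
  refine Finset.sum_congr rfl fun i hi => ?_
  rw [eq_sum_of_sub_smul_one_mulVec_eq hA hφorth hφeig (hadd i) _ (hx i hi),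
    eq_sum_of_sub_smul_one_mulVec_eq hA hφorth hφeig (hsub i) _ (hy i hi), hcompl,
    ← Finset.sum_add_distrib, Matrix.mulVec_sum, Matrix.sum_mulVec]
  refine Finset.sum_congr rfl fun j _ => ?_
  rw [hρ, hinv, Matrix.smul_mulVec, Matrix.vecMulVec_mulVec, hρg, op_smul_eq_smul, smul_smul,
    ← add_smul, Matrix.mulVec_smul, add_mul]
end
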